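/- For every $q\in\mathbb{R}$ there exists a Borel probability measure $\mu_q$ on $\partial\mathscr{A}_{1,2}^\ast$ with $\mu_q([w])=\mu([w])^q\,|w|^{\tau_{\mu,n}(q)}$ for every word $w$ of length $n$. Moreover $\mu_q([w])\le\mu([w])^q\,|w|^{\underline{\tau}_\mu(q)}$ for every finite word $w$, and there exists a strictly increasing sequence of integers $(n_k)$ such that for every $\varepsilon>0$ and all sufficiently large $k$, $\mu_q([w])\le\mu([w])^q\,|w|^{\tau_\mu(q)-\varepsilon}$ for every word $w$ of length $n_k$. -/

import Mathlib

open MeasureTheory Metric Set Filter Topology Classical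
open scoped ENNReal NNReal

noncomputable section

namespace MF

/-! ### Olsen's multifractal measures and dimension functions on a metric space -/

variable {X : Type} [MetricSpace X]

/-- The sum `∑ m(B(xᵢ,rᵢ))^q (2rᵢ)^t` associated with a countable family of centered balls. -/
def olsenSum [MeasurableSpace X] (m : Measure X) (q t : ℝ) {ι : Type}
    (c : ι → X) (r : ι → ℝ) : ℝ≥0∞ :=
  ∑' i, m (closedBall (c i) (r i)) ^ q * ENNReal.ofReal (2 * r i) ^ t

/-- `Olsen's 𝓗^{q,t}_{m,δ}`: infimum over countable centered `δ`-coverings of `E`. -/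
def Hdel [MeasurableSpace X] (m : Measure X) (q t δ : ℝ) (E : Set X) : ℝ≥0∞ :=
  ⨅ (ι : Type) (_ : Countable ι) (c : ι → X) (r : ι → ℝ)
    (_ : ∀ i, c i ∈ E) (_ : ∀ i, 0 < r i ∧ r i ≤ δ)
    (_ : E ⊆ ⋃ i, closedBall (c i) (r i)), olsenSum m q t c r

/-- Olsen's premeasure `𝓗̄^{q,t}_m` (limit, i.e. supremum, as `δ ↓ 0`). -/
def Hpre [MeasurableSpace X] (m : Measure X) (q t : ℝ) (E : Set X) : ℝ≥0∞ :=
  ⨆ (δ : ℝ) (_ : 0 < δ), Hdel m q t δ E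

/-- Olsen's multifractal Hausdorff measure `𝓗^{q,t}_m`. -/
def Hmeas [MeasurableSpace X] (m : Measure X) (q t : ℝ) (E : Set X) : ℝ≥0∞ :=
  ⨆ (F : Set X) (_ : F ⊆ E), Hpre m q t F

/-- `𝓟̄^{q,t}_{m,δ}`: supremum over countable centered `δ`-packings of `E`. -/
def Pdel [MeasurableSpace X] (m : Measure X) (q t δ : ℝ) (E : Set X) : ℝ≥0∞ :=
  ⨆ (ι : Type) (_ : Countable ι) (c : ι → X) (r : ι → ℝ)
    (_ : ∀ i, c i ∈ E) (_ : ∀ i, 0 < r i ∧ r i ≤ δ)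
    (_ : ∀ i j, i ≠ j → Disjoint (closedBall (c i) (r i)) (closedBall (c j) (r j))),
    olsenSum m q t c r

/-- Olsen's packing premeasure `𝓟̄^{q,t}_m` (limit, i.e. infimum, as `δ ↓ 0`). -/
def Ppre [MeasurableSpace X] (m : Measure X) (q t : ℝ) (E : Set X) : ℝ≥0∞ :=
  ⨅ (δ : ℝ) (_ : 0 < δ), Pdel m q t δ E

/-- Olsen's multifractal packing measure `𝓟^{q,t}_m`. -/
def Pmeas [MeasurableSpace X] (m : Measure X) (q t : ℝ) (E : Set X) : ℝ≥0∞ :=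
  ⨅ (En : ℕ → Set X) (_ : E ⊆ ⋃ n, En n), ∑' n, Ppre m q t (En n)

/-- The (topological) support of a measure on a metric space. -/
def msupport [MeasurableSpace X] (m : Measure X) : Set X :=
  {x | ∀ r : ℝ, 0 < r → 0 < m (ball x r)}

/-- Olsen's multifractal Hausdorff dimension function `b_m`. -/
def bFun [MeasurableSpace X] (m : Measure X) (q : ℝ) : ℝ :=
  sInf {t | Hmeas m q t (msupport m) = 0}

/-- Olsen's multifractal packing dimension function `B_m`. -/
def BFun [MeasurableSpace X] (m : Measure X) (q : ℝ) : ℝ :=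
  sInf {t | Pmeas m q t (msupport m) = 0}

/-- Olsen's function `τ_m`. -/
def tauFun [MeasurableSpace X] (m : Measure X) (q : ℝ) : ℝ :=
  sInf {t | Ppre m q t (msupport m) = 0}

/-- `t`-dimensional packing pre-premeasure at scale `δ`. -/
def pPdel (t δ : ℝ) (E : Set X) : ℝ≥0∞ :=
  ⨆ (ι : Type) (_ : Countable ι) (c : ι → X) (r : ι → ℝ)
    (_ : ∀ i, c i ∈ E) (_ : ∀ i, 0 < r i ∧ r i ≤ δ)
    (_ : ∀ i j, i ≠ j → Disjoint (closedBall (c i) (r i)) (closedBall (c j) (r j))),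
    ∑' i, ENNReal.ofReal (2 * r i) ^ t

/-- `t`-dimensional packing premeasure. -/
def pPpre (t : ℝ) (E : Set X) : ℝ≥0∞ := ⨅ (δ : ℝ) (_ : 0 < δ), pPdel t δ E

/-- `t`-dimensional packing measure. -/
def pPmeas (t : ℝ) (E : Set X) : ℝ≥0∞ :=
  ⨅ (En : ℕ → Set X) (_ : E ⊆ ⋃ n, En n), ∑' n, pPpre t (En n)

/-- Packing dimension of a set. -/
def packDim (E : Set X) : ℝ := sInf {t | pPmeas t E = 0}

/-- The level set `X_m(α)` of points of the support where the local Hölder exponent is `α`. -/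
def Xlev [MeasurableSpace X] (m : Measure X) (α : ℝ) : Set X :=
  {x | x ∈ msupport m ∧
    Tendsto (fun r => Real.log (m (closedBall x r)).toReal / Real.log r)
      (𝓝[>] (0 : ℝ)) (𝓝 α)}

/-- Legendre transform `f^*(x) = inf_y (xy + f(y))`. -/
def leg (f : ℝ → ℝ) (x : ℝ) : ℝ := ⨅ y : ℝ, (x * y + f y)

/-! ### The mixed symbolic space and inhomogeneous multinomial measures -/

/-- `j` is an index governed by the first alphabet:
`T (2k-1) ≤ j < T (2k)` for some `k ≥ 1`. -/
def isA (T : ℕ → ℕ) (j : ℕ) : Prop :=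
  ∃ k, 1 ≤ k ∧ T (2 * k - 1) ≤ j ∧ j < T (2 * k)

/-- The size of the alphabet at (0-based) position `n`, i.e. at paper index `j = n+1`. -/
def Yc (c₁ c₂ : ℕ) (T : ℕ → ℕ) (n : ℕ) : ℕ := if isA T (n + 1) then c₁ else c₂

/-- The mixed symbolic space `∂𝒜₁,₂* = ∏ⱼ Yⱼ`. -/
abbrev Omg (c₁ c₂ : ℕ) (T : ℕ → ℕ) : Type := ∀ n : ℕ, Fin (Yc c₁ c₂ T n)

/-- Finite words of length `n`. -/
abbrev Word (c₁ c₂ : ℕ) (T : ℕ → ℕ) (n : ℕ) : Type :=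
  ∀ i : Fin n, Fin (Yc c₁ c₂ T i.val)

/-- `N_n`: the number of indices `1 ≤ j ≤ n` governed by the first alphabet. -/
def Ncount (T : ℕ → ℕ) (n : ℕ) : ℕ := ((Finset.Icc 1 n).filter (isA T)).card

/-- Diameter `c₁^{-N_n} c₂^{-(n-N_n)}` of a cylinder of generation `n`. -/
def Dw (c₁ c₂ : ℕ) (T : ℕ → ℕ) (n : ℕ) : ℝ :=
  ((c₁ : ℝ) ^ Ncount T n * (c₂ : ℝ) ^ (n - Ncount T n))⁻¹

/-- The cylinder `[w]` defined by a finite word `w`. -/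
def cyl (c₁ c₂ : ℕ) (T : ℕ → ℕ) (n : ℕ) (w : Word c₁ c₂ T n) : Set (Omg c₁ c₂ T) :=
  {x | ∀ i : Fin n, x i.val = w i}

/-- The mass `∏_{j≤n} p_j` given to the cylinder `[w]` by the inhomogeneous
multinomial measure with weights `a` and `b`. -/
def cylWeight (c₁ c₂ : ℕ) (T : ℕ → ℕ) (a b : ℕ → ℝ) (n : ℕ) (w : Word c₁ c₂ T n) : ℝ :=
  ∏ i : Fin n, (if isA T (i.val + 1) then a (w i).val else b (w i).val)

/-- `θ(q) = log_c (p₁^q + ⋯ + p_c^q)`. -/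
def theta (c : ℕ) (p : ℕ → ℝ) (q : ℝ) : ℝ :=
  Real.logb c (∑ i ∈ Finset.range c, p i ^ q)

/-- `τ_{μ,n}(q)`, defined by `∑_{z ∈ 𝒜₁,₂ⁿ} μ([z])^q = |w|^{-τ_{μ,n}(q)}`. -/
def tauN (c₁ c₂ : ℕ) (T : ℕ → ℕ) (a b : ℕ → ℝ) (q : ℝ) (n : ℕ) : ℝ :=
  Real.log (∑ z : Word c₁ c₂ T n, cylWeight c₁ c₂ T a b n z ^ q) /
    Real.log ((c₁ : ℝ) ^ Ncount T n * (c₂ : ℝ) ^ (n - Ncount T n))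

/-- The natural projection `γ : ∂𝒜₁,₂* → [0,1]`,
`γ(ε₁ε₂⋯) = ∑_{n≥1} εₙ c₁^{-N_n} c₂^{-(n-N_n)}`. -/
def gammaMap (c₁ c₂ : ℕ) (T : ℕ → ℕ) (x : Omg c₁ c₂ T) : ℝ :=
  ∑' n : ℕ, ((x n).val : ℝ) * Dw c₁ c₂ T (n + 1)

/-- The normalized weights `pᵢ^q / (p₁^q + ⋯ + p_c^q)`. -/
def taW (c : ℕ) (p : ℕ → ℝ) (q : ℝ) (i : ℕ) : ℝ :=
  p i ^ q / ∑ j ∈ Finset.range c, p j ^ q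

/-- `s₁ = min{max aᵢ, max bⱼ}`. -/
def sOne (c₁ c₂ : ℕ) (a b : ℕ → ℝ) : ℝ :=
  min (sSup {x | ∃ i < c₁, a i = x}) (sSup {x | ∃ j < c₂, b j = x})

/-- `s₂ = max{min aᵢ, min bⱼ}`. -/
def sTwo (c₁ c₂ : ℕ) (a b : ℕ → ℝ) : ℝ :=
  max (sInf {x | ∃ i < c₁, a i = x}) (sInf {x | ∃ j < c₂, b j = x})

/-- Entropy `h(p) = -∑_{i<2} pᵢ log₂ pᵢ`. -/
def hEnt (p : ℕ → ℝ) : ℝ := -(∑ i ∈ Finset.range 2, p i * Real.logb 2 (p i))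

/-! ### Dyadic intervals -/

/-- The family `𝓕_n` of dyadic intervals of generation `n` in `[0,1]`. -/
def Fnfam (n : ℕ) : Set (Set ℝ) :=
  {I | ∃ j : ℕ, j < 2 ^ n ∧ I = Set.Icc ((j : ℝ) / 2 ^ n) (((j : ℝ) + 1) / 2 ^ n)}

/-- Index of the dyadic interval of generation `n` containing `x`
(the left one when `x` is dyadic). -/
def dyadIdx (n : ℕ) (x : ℝ) : ℤ := ⌈x * 2 ^ n⌉ - 1

/-- `I_n(x)`: the dyadic interval of generation `n` containing `x`
(the left one when `x` is dyadic). -/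
def Idyad (n : ℕ) (x : ℝ) : Set ℝ :=
  Set.Icc ((dyadIdx n x : ℝ) / 2 ^ n) (((dyadIdx n x : ℝ) + 1) / 2 ^ n)

/-- `I_n(x)⁺`: the right neighbour of `I_n(x)` in `𝓕_n`. -/
def IdyadP (n : ℕ) (x : ℝ) : Set ℝ :=
  Set.Icc (((dyadIdx n x : ℝ) + 1) / 2 ^ n) (((dyadIdx n x : ℝ) + 2) / 2 ^ n)

/-- `I_n(x)⁻`: the left neighbour of `I_n(x)` in `𝓕_n`. -/
def IdyadM (n : ℕ) (x : ℝ) : Set ℝ :=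
  Set.Icc (((dyadIdx n x : ℝ) - 1) / 2 ^ n) ((dyadIdx n x : ℝ) / 2 ^ n)

/-! ### Counting the indices governed by each alphabet -/

lemma Ncount_zero (T : ℕ → ℕ) : Ncount T 0 = 0 := by simp [Ncount]

lemma Ncount_succ (T : ℕ → ℕ) (n : ℕ) :
    Ncount T (n + 1) = Ncount T n + if isA T (n + 1) then 1 else 0 := by
  unfold Ncount
  rw [← Finset.insert_Icc_right_eq_Icc_add_one (by omega), Finset.filter_insert]
  split_ifs <;> simp

lemma Ncount_le (T : ℕ → ℕ) (n : ℕ) : Ncount T n ≤ n := by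
  simpa [Ncount] using Finset.card_filter_le (Finset.Icc 1 n) (isA T)

lemma sub_Ncount (T : ℕ → ℕ) (n : ℕ) :
    n - Ncount T n = ((Finset.Icc 1 n).filter fun j => ¬ isA T j).card := by
  have h := Finset.card_filter_add_card_filter_not (s := Finset.Icc 1 n) (isA T)
  rw [Nat.card_Icc] at h
  unfold Ncount
  omega

lemma prod_ite_isA (T : ℕ → ℕ) (x y : ℝ) (n : ℕ) :
    ∏ i : Fin n, (if isA T (i.val + 1) then x else y) =
      x ^ Ncount T n * y ^ (n - Ncount T n) := by
  rw [Fin.prod_univ_eq_prod_range (fun i => if isA T (i + 1) then x else y)]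
  induction n with
  | zero => simp [Ncount_zero]
  | succ n ih =>
    have h := Ncount_le T n
    rw [Finset.prod_range_succ, ih, Ncount_succ]
    split_ifs
    · rw [Nat.add_sub_add_right]; ring
    · rw [add_zero, Nat.sub_add_comm h]; ring

section Growth

variable {T : ℕ → ℕ}

lemma le_of_index_le (hTmono : ∀ k, 1 ≤ k → T k < T (k + 1)) {m n : ℕ}
    (hm : 1 ≤ m) (hmn : m ≤ n) : T m ≤ T n := by
  induction n, hmn using Nat.le_induction with
  | base => rfl
  | succ n hn ih => exact ih.trans (hTmono n (hm.trans hn)).le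

lemma sub_Ncount_le (k : ℕ) : T (2 * k + 2) - 1 - Ncount T (T (2 * k + 2) - 1) ≤ T (2 * k + 1) := by
  rw [sub_Ncount]
  refine (Finset.card_le_card (t := Finset.range (T (2 * k + 1))) fun j hj => ?_).trans
    (Finset.card_range _).le
  simp only [Finset.mem_filter, Finset.mem_Icc, Finset.mem_range] at hj ⊢
  by_contra! h
  exact hj.2 ⟨k + 1, by omega, h, by rw [show 2 * (k + 1) = 2 * k + 2 by ring]; omega⟩

lemma Ncount_le_of_odd (hTmono : ∀ k, 1 ≤ k → T k < T (k + 1)) (k : ℕ) :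
    Ncount T (T (2 * k + 3) - 1) ≤ T (2 * k + 2) := by
  unfold Ncount
  refine (Finset.card_le_card (t := Finset.range (T (2 * k + 2))) fun j hj => ?_).trans
    (Finset.card_range _).le
  simp only [Finset.mem_filter, Finset.mem_Icc, Finset.mem_range] at hj ⊢
  obtain ⟨⟨h1, h2⟩, l, hl, hl1, hl2⟩ := hj
  by_contra! h
  rcases le_or_gt l (k + 1) with hk | hk
  · have := le_of_index_le hTmono (m := 2 * l) (n := 2 * k + 2) (by omega) (by omega)
    omega
  · have := le_of_index_le hTmono (m := 2 * k + 3) (n := 2 * l - 1) (by omega) (by omega)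
    omega

lemma strictMono_sub_one {φ : ℕ → ℕ} (hT1 : T 1 = 1) (hTmono : ∀ k, 1 ≤ k → T k < T (k + 1))
    (hφ1 : ∀ k, 1 ≤ φ k) (hφ : StrictMono φ) : StrictMono fun k => T (φ k) - 1 := by
  intro k l hkl
  have h1 := le_of_index_le hTmono le_rfl (hφ1 k)
  have h2 := hTmono (φ k) (hφ1 k)
  have h3 := le_of_index_le hTmono (m := φ k + 1) (n := φ l) (by omega) (hφ hkl)
  show T (φ k) - 1 < T (φ l) - 1
  omega

lemma tendsto_div_of_le (hT1 : T 1 = 1) (hTmono : ∀ k, 1 ≤ k → T k < T (k + 1))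
    (hTrat : Tendsto (fun k => (T (k + 1) : ℝ) / (T k : ℝ)) atTop atTop)
    {φ : ℕ → ℕ} (hφ1 : ∀ k, 1 ≤ φ k) (hφ : StrictMono φ) {M : ℕ → ℕ}
    (hM : ∀ k, M (T (φ k + 1) - 1) ≤ T (φ k)) :
    Tendsto (fun k => (M (T (φ k + 1) - 1) : ℝ) / ((T (φ k + 1) - 1 : ℕ) : ℝ)) atTop (𝓝 0) := by
  have h0 : Tendsto (fun k => 2 * ((T (φ k + 1) : ℝ) / (T (φ k) : ℝ))⁻¹) atTop (𝓝 0) := by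
    simpa using ((hTrat.comp hφ.tendsto_atTop).inv_tendsto_atTop).const_mul 2
  refine squeeze_zero (fun k => by positivity) (fun k => ?_) h0
  have h1 : 1 ≤ T (φ k) := hT1 ▸ le_of_index_le hTmono le_rfl (hφ1 k)
  have h2 := hTmono (φ k) (hφ1 k)
  have h3 : ((T (φ k + 1) : ℕ) : ℝ) ≤ 2 * ((T (φ k + 1) - 1 : ℕ) : ℝ) := by
    exact_mod_cast (by omega : T (φ k + 1) ≤ 2 * (T (φ k + 1) - 1))
  have h4 : (M (T (φ k + 1) - 1) : ℝ) ≤ T (φ k) := by exact_mod_cast hM k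
  have h5 : (0 : ℝ) < T (φ k + 1) := by exact_mod_cast (by omega : 0 < T (φ k + 1))
  rw [inv_div, ← mul_div_assoc, div_le_div_iff₀ (by linarith) h5]
  nlinarith [mul_le_mul h4 h3 h5.le (by positivity)]

end Growth

/-! ### The product measure with normalized weights -/

lemma sum_rpow_pos {c : ℕ} (hc : 0 < c) {p : ℕ → ℝ} (hp : ∀ i, i < c → 0 < p i) (q : ℝ) :
    0 < ∑ i ∈ Finset.range c, p i ^ q :=
  Finset.sum_pos (fun i hi => Real.rpow_pos_of_pos (hp i (Finset.mem_range.1 hi)) q)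
    ⟨0, Finset.mem_range.2 hc⟩

section Product

variable (c₁ c₂ : ℕ) (T : ℕ → ℕ) (a b : ℕ → ℝ) (q : ℝ)

/-- The weight of the letter `i` at (0-based) position `n`. -/
def letterWeight (n i : ℕ) : ℝ := if isA T (n + 1) then a i else b i

/-- The sum of the `q`-th powers of the weights of the letters at (0-based) position `n`. -/
def letterSum (n : ℕ) : ℝ :=
  if isA T (n + 1) then ∑ i ∈ Finset.range c₁, a i ^ q else ∑ j ∈ Finset.range c₂, b j ^ q

/-- The distribution of the letter at (0-based) position `n`, with probabilities proportional to
the `q`-th powers of the weights. -/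
def letterMeasure (n : ℕ) : Measure (Fin (Yc c₁ c₂ T n)) :=
  ∑ i : Fin (Yc c₁ c₂ T n),
    ENNReal.ofReal (letterWeight T a b n i ^ q / letterSum c₁ c₂ T a b q n) • Measure.dirac i

lemma sum_letterWeight_rpow (n : ℕ) :
    ∑ i : Fin (Yc c₁ c₂ T n), letterWeight T a b n i ^ q = letterSum c₁ c₂ T a b q n := by
  rw [Fin.sum_univ_eq_sum_range (fun i => letterWeight T a b n i ^ q)]
  unfold letterWeight letterSum Yc
  split_ifs <;> rfl

lemma letterMeasure_singleton (n : ℕ) (i : Fin (Yc c₁ c₂ T n)) :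
    letterMeasure c₁ c₂ T a b q n {i} =
      ENNReal.ofReal (letterWeight T a b n i ^ q / letterSum c₁ c₂ T a b q n) := by
  rw [letterMeasure, Measure.finsetSum_apply, Finset.sum_eq_single i]
  · simp
  · intro j _ hj
    simp [hj]
  · simp

lemma prod_letterSum (n : ℕ) :
    ∏ i : Fin n, letterSum c₁ c₂ T a b q i =
      (∑ i ∈ Finset.range c₁, a i ^ q) ^ Ncount T n *
        (∑ j ∈ Finset.range c₂, b j ^ q) ^ (n - Ncount T n) :=
  prod_ite_isA T _ _ n

variable {c₁ c₂ T a b}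

lemma letterWeight_pos (ha : ∀ i, i < c₁ → 0 < a i) (hb : ∀ j, j < c₂ → 0 < b j) (n : ℕ)
    (i : Fin (Yc c₁ c₂ T n)) : 0 < letterWeight T a b n i := by
  have h : i.val < if isA T (n + 1) then c₁ else c₂ := i.isLt
  unfold letterWeight
  split_ifs at h ⊢
  · exact ha _ h
  · exact hb _ h

lemma letterSum_pos (hc₁ : 2 ≤ c₁) (hc₂ : 2 ≤ c₂) (ha : ∀ i, i < c₁ → 0 < a i)
    (hb : ∀ j, j < c₂ → 0 < b j) (n : ℕ) : 0 < letterSum c₁ c₂ T a b q n := by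
  unfold letterSum
  split_ifs
  · exact sum_rpow_pos (by omega) ha q
  · exact sum_rpow_pos (by omega) hb q

lemma isProbabilityMeasure_letterMeasure (hc₁ : 2 ≤ c₁) (hc₂ : 2 ≤ c₂)
    (ha : ∀ i, i < c₁ → 0 < a i) (hb : ∀ j, j < c₂ → 0 < b j) (n : ℕ) :
    IsProbabilityMeasure (letterMeasure c₁ c₂ T a b q n) := by
  have hS := letterSum_pos (T := T) q hc₁ hc₂ ha hb n
  constructor
  rw [letterMeasure, Measure.finsetSum_apply]
  simp only [Measure.smul_apply, measure_univ, smul_eq_mul, mul_one]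
  rw [← ENNReal.ofReal_sum_of_nonneg, ← Finset.sum_div, sum_letterWeight_rpow, div_self hS.ne',
    ENNReal.ofReal_one]
  exact fun i _ => div_nonneg (Real.rpow_nonneg (letterWeight_pos ha hb n i).le q) hS.le

lemma cylWeight_rpow (ha : ∀ i, i < c₁ → 0 < a i) (hb : ∀ j, j < c₂ → 0 < b j) (n : ℕ)
    (w : Word c₁ c₂ T n) :
    cylWeight c₁ c₂ T a b n w ^ q = ∏ i : Fin n, letterWeight T a b i (w i) ^ q :=
  (Real.finsetProd_rpow Finset.univ (fun i : Fin n => letterWeight T a b i (w i))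
    (fun i _ => (letterWeight_pos ha hb i (w i)).le) q).symm

lemma sum_cylWeight_rpow (ha : ∀ i, i < c₁ → 0 < a i) (hb : ∀ j, j < c₂ → 0 < b j) (n : ℕ) :
    ∑ z : Word c₁ c₂ T n, cylWeight c₁ c₂ T a b n z ^ q =
      ∏ i : Fin n, letterSum c₁ c₂ T a b q i := by
  simp_rw [cylWeight_rpow q ha hb, ← sum_letterWeight_rpow]
  rw [Finset.prod_univ_sum, Fintype.piFinset_univ]

lemma cyl_eq_pi (n : ℕ) (w : Word c₁ c₂ T n) :
    cyl c₁ c₂ T n w = Set.pi (Finset.range n : Set ℕ)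
      (fun i => if h : i < n then ({w ⟨i, h⟩} : Set (Fin (Yc c₁ c₂ T i))) else Set.univ) := by
  ext x
  simp only [cyl, Set.mem_ofPred_eq, Set.mem_pi, Finset.coe_range, Set.mem_Iio]
  refine ⟨fun h i hi => ?_, fun h i => ?_⟩
  · simpa [hi] using h ⟨i, hi⟩
  · simpa using h i i.isLt

lemma infinitePi_letterMeasure_cyl (hc₁ : 2 ≤ c₁) (hc₂ : 2 ≤ c₂)
    (ha : ∀ i, i < c₁ → 0 < a i) (hb : ∀ j, j < c₂ → 0 < b j) (n : ℕ) (w : Word c₁ c₂ T n) :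
    Measure.infinitePi (letterMeasure c₁ c₂ T a b q) (cyl c₁ c₂ T n w) =
      ENNReal.ofReal (cylWeight c₁ c₂ T a b n w ^ q *
        (∏ i : Fin n, letterSum c₁ c₂ T a b q i)⁻¹) := by
  have := isProbabilityMeasure_letterMeasure (T := T) q hc₁ hc₂ ha hb
  rw [cyl_eq_pi, Measure.infinitePi_pi _ (fun _ _ => MeasurableSet.of_discrete),
    cylWeight_rpow q ha hb, ← div_eq_mul_inv, ← Finset.prod_div_distrib,
    ENNReal.ofReal_prod_of_nonneg, ← Fin.prod_univ_eq_prod_range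
      (fun i => letterMeasure c₁ c₂ T a b q i
        (if h : i < n then ({w ⟨i, h⟩} : Set (Fin (Yc c₁ c₂ T i))) else Set.univ))]
  · refine Finset.prod_congr rfl fun i _ => ?_
    rw [dif_pos i.isLt, letterMeasure_singleton]
  · exact fun i _ => div_nonneg (Real.rpow_nonneg (letterWeight_pos ha hb i (w i)).le q)
      (letterSum_pos q hc₁ hc₂ ha hb i).le

end Product

/-! ### The exponents -/

/-- The value of `tauN` when a proportion `x` of the indices is governed by the second alphabet,
in terms of the logarithms of the sizes of the alphabets and of the power sums. -/
def mixedExponent (l₁ l₂ L₁ L₂ x : ℝ) : ℝ :=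
  ((1 - x) * l₁ + x * l₂) / ((1 - x) * L₁ + x * L₂)

lemma mixedExponent_mem {l₁ l₂ L₁ L₂ x : ℝ} (hL₁ : 0 < L₁) (hL₂ : 0 < L₂) (hx0 : 0 ≤ x)
    (hx1 : x ≤ 1) :
    min (l₁ / L₁) (l₂ / L₂) ≤ mixedExponent l₁ l₂ L₁ L₂ x ∧
      mixedExponent l₁ l₂ L₁ L₂ x ≤ max (l₁ / L₁) (l₂ / L₂) := by
  have hd : 0 < (1 - x) * L₁ + x * L₂ := by
    rcases hx0.eq_or_lt with rfl | h
    · simpa using hL₁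
    · nlinarith [mul_nonneg (sub_nonneg.2 hx1) hL₁.le, mul_pos h hL₂]
  have e₁ := mul_nonneg (sub_nonneg.2 hx1) hL₁.le
  have e₂ := mul_nonneg hx0 hL₂.le
  have h₁ : (1 - x) * l₁ = (1 - x) * L₁ * (l₁ / L₁) := by field_simp
  have h₂ : x * l₂ = x * L₂ * (l₂ / L₂) := by field_simp
  unfold mixedExponent
  rw [le_div_iff₀ hd, div_le_iff₀ hd, h₁, h₂]
  constructor
  · nlinarith [mul_le_mul_of_nonneg_left (min_le_left (l₁ / L₁) (l₂ / L₂)) e₁,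
      mul_le_mul_of_nonneg_left (min_le_right (l₁ / L₁) (l₂ / L₂)) e₂]
  · nlinarith [mul_le_mul_of_nonneg_left (le_max_left (l₁ / L₁) (l₂ / L₂)) e₁,
      mul_le_mul_of_nonneg_left (le_max_right (l₁ / L₁) (l₂ / L₂)) e₂]

lemma tendsto_mixedExponent_zero {l₁ l₂ L₁ L₂ : ℝ} (hL₁ : 0 < L₁) :
    Tendsto (mixedExponent l₁ l₂ L₁ L₂) (𝓝 0) (𝓝 (l₁ / L₁)) := by
  have h : ContinuousAt (mixedExponent l₁ l₂ L₁ L₂) 0 := by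
    unfold mixedExponent
    exact ContinuousAt.div (by fun_prop) (by fun_prop) (by simpa using hL₁.ne')
  simpa [ContinuousAt, mixedExponent] using h

lemma tendsto_mixedExponent_one {l₁ l₂ L₁ L₂ : ℝ} (hL₂ : 0 < L₂) :
    Tendsto (mixedExponent l₁ l₂ L₁ L₂) (𝓝 1) (𝓝 (l₂ / L₂)) := by
  have h : ContinuousAt (mixedExponent l₁ l₂ L₁ L₂) 1 := by
    unfold mixedExponent
    exact ContinuousAt.div (by fun_prop) (by fun_prop) (by simpa using hL₂.ne')
  simpa [ContinuousAt, mixedExponent] using h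

lemma one_le_prod_pow {c₁ c₂ : ℕ} (hc₁ : 2 ≤ c₁) (hc₂ : 2 ≤ c₂) (m n : ℕ) :
    (1 : ℝ) ≤ (c₁ : ℝ) ^ m * (c₂ : ℝ) ^ n := by
  exact_mod_cast Nat.one_le_iff_ne_zero.2
    (mul_ne_zero (pow_ne_zero _ (by omega)) (pow_ne_zero _ (by omega)))

lemma one_lt_prod_pow {c₁ c₂ : ℕ} (hc₁ : 2 ≤ c₁) (hc₂ : 2 ≤ c₂) (T : ℕ → ℕ) {n : ℕ}
    (hn : n ≠ 0) : (1 : ℝ) < (c₁ : ℝ) ^ Ncount T n * (c₂ : ℝ) ^ (n - Ncount T n) := by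
  have h₁ : (2 : ℝ) ≤ c₁ := by exact_mod_cast hc₁
  have h₂ : (2 : ℝ) ≤ c₂ := by exact_mod_cast hc₂
  calc (1 : ℝ) < 2 ^ n := one_lt_pow₀ one_lt_two hn
    _ = 2 ^ Ncount T n * 2 ^ (n - Ncount T n) := by
        rw [← pow_add, Nat.add_sub_cancel' (Ncount_le T n)]
    _ ≤ _ := by gcongr

lemma Dw_rpow_tauN {c₁ c₂ : ℕ} {T : ℕ → ℕ} {a b : ℕ → ℝ} (q : ℝ) (hc₁ : 2 ≤ c₁) (hc₂ : 2 ≤ c₂)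
    (ha : ∀ i, i < c₁ → 0 < a i) (hb : ∀ j, j < c₂ → 0 < b j) (n : ℕ) :
    Dw c₁ c₂ T n ^ tauN c₁ c₂ T a b q n = (∏ i : Fin n, letterSum c₁ c₂ T a b q i)⁻¹ := by
  rcases eq_or_ne n 0 with rfl | hn
  · simp [Dw, Ncount_zero]
  have hP := one_lt_prod_pow hc₁ hc₂ T hn
  have hS : 0 < ∏ i : Fin n, letterSum c₁ c₂ T a b q i :=
    Finset.prod_pos fun i _ => letterSum_pos q hc₁ hc₂ ha hb i
  rw [Dw, tauN, sum_cylWeight_rpow q ha hb, Real.inv_rpow (by linarith),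
    Real.rpow_def_of_pos (by linarith), mul_div_cancel₀ _ (Real.log_pos hP).ne', Real.exp_log hS]

lemma tauN_eq_mixedExponent {c₁ c₂ : ℕ} {T : ℕ → ℕ} {a b : ℕ → ℝ} (q : ℝ) (hc₁ : 2 ≤ c₁)
    (hc₂ : 2 ≤ c₂) (ha : ∀ i, i < c₁ → 0 < a i) (hb : ∀ j, j < c₂ → 0 < b j) {n : ℕ}
    (hn : n ≠ 0) :
    tauN c₁ c₂ T a b q n =
      mixedExponent (Real.log (∑ i ∈ Finset.range c₁, a i ^ q))
        (Real.log (∑ j ∈ Finset.range c₂, b j ^ q)) (Real.log c₁) (Real.log c₂)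
        (((n - Ncount T n : ℕ) : ℝ) / n) := by
  have hA := sum_rpow_pos (by omega) ha q
  have hB := sum_rpow_pos (by omega) hb q
  have hn' : (n : ℝ) ≠ 0 := by exact_mod_cast hn
  have hx : (1 : ℝ) - ((n - Ncount T n : ℕ) : ℝ) / n = (Ncount T n : ℝ) / n := by
    rw [Nat.cast_sub (Ncount_le T n)]
    field_simp
    ring
  have hc₁' : (c₁ : ℝ) ≠ 0 := by exact_mod_cast (by omega : c₁ ≠ 0)
  have hc₂' : (c₂ : ℝ) ≠ 0 := by exact_mod_cast (by omega : c₂ ≠ 0)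
  rw [tauN, sum_cylWeight_rpow q ha hb, prod_letterSum, mixedExponent, hx,
    Real.log_mul (pow_ne_zero _ hA.ne') (pow_ne_zero _ hB.ne'),
    Real.log_mul (pow_ne_zero _ hc₁') (pow_ne_zero _ hc₂')]
  simp only [Real.log_pow]
  rw [div_mul_eq_mul_div, div_mul_eq_mul_div, div_mul_eq_mul_div, div_mul_eq_mul_div, ← add_div,
    ← add_div, div_div_div_cancel_right₀ hn']

/-- A sequence eventually in an interval `[min s t, max s t]`, both of whose endpoints are limits
along subsequences, has lower and upper limits in terms of these endpoints. -/
lemma liminf_limsup_of_subseq {u : ℕ → ℝ} {s t : ℝ}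
    (hu : ∀ n, n ≠ 0 → min s t ≤ u n ∧ u n ≤ max s t) {φ ψ : ℕ → ℕ} (hφ : StrictMono φ)
    (hψ : StrictMono ψ) (hs : Tendsto (u ∘ φ) atTop (𝓝 s)) (ht : Tendsto (u ∘ ψ) atTop (𝓝 t)) :
    (∀ n, n ≠ 0 → liminf u atTop ≤ u n) ∧
      ∃ nk : ℕ → ℕ, StrictMono nk ∧ ∀ ε : ℝ, 0 < ε →
        ∀ᶠ k in atTop, limsup u atTop - ε ≤ u (nk k) := by
  have hlow : ∀ᶠ n in atTop, min s t ≤ u n :=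
    (eventually_ne_atTop 0).mono fun n hn => (hu n hn).1
  have hup : ∀ᶠ n in atTop, u n ≤ max s t :=
    (eventually_ne_atTop 0).mono fun n hn => (hu n hn).2
  have hlim : ∀ {χ : ℕ → ℕ} {v : ℝ}, StrictMono χ → Tendsto (u ∘ χ) atTop (𝓝 v) →
      liminf u atTop ≤ v := by
    intro χ v hχ hv
    refine le_of_forall_gt_imp_ge_of_dense fun y hy => ?_
    exact liminf_le_of_frequently_le
      (hχ.tendsto_atTop.frequently ((hv.eventually_le_const hy).frequently)) ⟨_, hlow⟩
  have hsup : limsup u atTop ≤ max s t :=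
    limsup_le_of_le (IsCoboundedUnder.of_frequently_ge hlow.frequently) hup
  refine ⟨fun n hn => (le_min (hlim hφ hs) (hlim hψ ht)).trans (hu n hn).1, ?_⟩
  have key : ∀ {χ : ℕ → ℕ} {v : ℝ}, Tendsto (u ∘ χ) atTop (𝓝 v) → limsup u atTop ≤ v →
      ∀ ε : ℝ, 0 < ε → ∀ᶠ k in atTop, limsup u atTop - ε ≤ u (χ k) := fun hv hle ε hε =>
    hv.eventually_const_le (by linarith)
  rcases le_total s t with h | h
  · exact ⟨ψ, hψ, key ht (max_eq_right h ▸ hsup)⟩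
  · exact ⟨φ, hφ, key hs (max_eq_left h ▸ hsup)⟩

lemma tauN_liminf_limsup {c₁ c₂ : ℕ} {T : ℕ → ℕ} {a b : ℕ → ℝ} (q : ℝ) (hc₁ : 2 ≤ c₁)
    (hc₂ : 2 ≤ c₂) (hT1 : T 1 = 1) (hTmono : ∀ k, 1 ≤ k → T k < T (k + 1))
    (hTrat : Tendsto (fun k => (T (k + 1) : ℝ) / (T k : ℝ)) atTop atTop)
    (ha : ∀ i, i < c₁ → 0 < a i) (hb : ∀ j, j < c₂ → 0 < b j) :
    (∀ n, n ≠ 0 → liminf (tauN c₁ c₂ T a b q) atTop ≤ tauN c₁ c₂ T a b q n) ∧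
      ∃ nk : ℕ → ℕ, StrictMono nk ∧ ∀ ε : ℝ, 0 < ε →
        ∀ᶠ k in atTop, limsup (tauN c₁ c₂ T a b q) atTop - ε ≤ tauN c₁ c₂ T a b q (nk k) := by
  have hL₁ : 0 < Real.log c₁ := Real.log_pos (by exact_mod_cast hc₁)
  have hL₂ : 0 < Real.log c₂ := Real.log_pos (by exact_mod_cast hc₂)
  have hφ : StrictMono fun k => 2 * k + 1 := fun _ _ _ => by dsimp only; omega
  have hψ : StrictMono fun k => 2 * k + 2 := fun _ _ _ => by dsimp only; omega
  have hχ : StrictMono fun k => 2 * k + 3 := fun _ _ _ => by dsimp only; omega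
  have hφ' : StrictMono fun k => T (2 * k + 2) - 1 :=
    strictMono_sub_one hT1 hTmono (fun _ => by omega) hψ
  have hψ' : StrictMono fun k => T (2 * k + 3) - 1 :=
    strictMono_sub_one hT1 hTmono (fun _ => by omega) hχ
  have hs := tendsto_div_of_le hT1 hTmono hTrat (fun _ => by omega) hφ
    (M := fun n => n - Ncount T n) sub_Ncount_le
  have ht := tendsto_div_of_le hT1 hTmono hTrat (fun _ => by omega) hψ
    (M := Ncount T) (Ncount_le_of_odd hTmono)
  have hs' := (tendsto_mixedExponent_zero (l₁ := Real.log (∑ i ∈ Finset.range c₁, a i ^ q))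
    (l₂ := Real.log (∑ j ∈ Finset.range c₂, b j ^ q)) (L₂ := Real.log c₂) hL₁).comp hs
  have ht' := (tendsto_mixedExponent_one (l₁ := Real.log (∑ i ∈ Finset.range c₁, a i ^ q))
    (l₂ := Real.log (∑ j ∈ Finset.range c₂, b j ^ q)) (L₁ := Real.log c₁) hL₂).comp
      (by simpa using ht.const_sub 1)
  refine liminf_limsup_of_subseq (fun n hn => ?_) hφ' hψ' (hs'.congr' ?_) (ht'.congr' ?_)
  · rw [tauN_eq_mixedExponent q hc₁ hc₂ ha hb hn]
    exact mixedExponent_mem hL₁ hL₂ (by positivity)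
      (div_le_one_of_le₀ (by exact_mod_cast Nat.sub_le _ _) (by positivity))
  · filter_upwards [hφ'.tendsto_atTop.eventually_ne_atTop 0] with k hk
    exact (tauN_eq_mixedExponent q hc₁ hc₂ ha hb hk).symm
  · filter_upwards [hψ'.tendsto_atTop.eventually_ne_atTop 0] with k hk
    refine Eq.trans ?_ (tauN_eq_mixedExponent q hc₁ hc₂ ha hb hk).symm
    have hk' : ((T (2 * k + 3) - 1 : ℕ) : ℝ) ≠ 0 := by exact_mod_cast hk
    rw [Nat.cast_sub (Ncount_le T _), sub_div, div_self hk']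
    rfl

/-- the auxiliary measures `μ_q`. -/
theorem stmt2 (c₁ c₂ : ℕ) (hc₁ : 2 ≤ c₁) (hc₂ : 2 ≤ c₂)
    (T : ℕ → ℕ) (hT1 : T 1 = 1) (hTmono : ∀ k, 1 ≤ k → T k < T (k + 1))
    (hTrat : Tendsto (fun k => (T (k + 1) : ℝ) / (T k : ℝ)) atTop atTop)
    (a b : ℕ → ℝ) (ha : ∀ i, i < c₁ → 0 < a i ∧ a i < 1)
    (hb : ∀ j, j < c₂ → 0 < b j ∧ b j < 1)
    (hsa : ∑ i ∈ Finset.range c₁, a i = 1) (hsb : ∑ j ∈ Finset.range c₂, b j = 1)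
    (q : ℝ) :
    ∃ μq : Measure (Omg c₁ c₂ T), IsProbabilityMeasure μq ∧
      (∀ (n : ℕ) (w : Word c₁ c₂ T n),
        μq (cyl c₁ c₂ T n w) =
          ENNReal.ofReal (cylWeight c₁ c₂ T a b n w ^ q *
            Dw c₁ c₂ T n ^ tauN c₁ c₂ T a b q n)) ∧
      (∀ (n : ℕ) (w : Word c₁ c₂ T n),
        μq (cyl c₁ c₂ T n w) ≤
          ENNReal.ofReal (cylWeight c₁ c₂ T a b n w ^ q *
            Dw c₁ c₂ T n ^ Filter.liminf (tauN c₁ c₂ T a b q) atTop)) ∧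
      ∃ nk : ℕ → ℕ, StrictMono nk ∧
        ∀ ε : ℝ, 0 < ε → ∀ᶠ k in atTop, ∀ w : Word c₁ c₂ T (nk k),
          μq (cyl c₁ c₂ T (nk k) w) ≤
            ENNReal.ofReal (cylWeight c₁ c₂ T a b (nk k) w ^ q *
              Dw c₁ c₂ T (nk k) ^ (Filter.limsup (tauN c₁ c₂ T a b q) atTop - ε)) := by
  have ha' : ∀ i, i < c₁ → 0 < a i := fun i hi => (ha i hi).1
  have hb' : ∀ j, j < c₂ → 0 < b j := fun j hj => (hb j hj).1
  obtain ⟨hlim, nk, hnk, hsup⟩ := tauN_liminf_limsup q hc₁ hc₂ hT1 hTmono hTrat ha' hb'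
  have := isProbabilityMeasure_letterMeasure (T := T) q hc₁ hc₂ ha' hb'
  have hcyl : ∀ (n : ℕ) (w : Word c₁ c₂ T n),
      Measure.infinitePi (letterMeasure c₁ c₂ T a b q) (cyl c₁ c₂ T n w) =
        ENNReal.ofReal (cylWeight c₁ c₂ T a b n w ^ q *
          Dw c₁ c₂ T n ^ tauN c₁ c₂ T a b q n) := fun n w => by
    rw [infinitePi_letterMeasure_cyl q hc₁ hc₂ ha' hb', Dw_rpow_tauN q hc₁ hc₂ ha' hb']
  have hle : ∀ (n : ℕ) (w : Word c₁ c₂ T n) (s : ℝ), s ≤ tauN c₁ c₂ T a b q n →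
      Measure.infinitePi (letterMeasure c₁ c₂ T a b q) (cyl c₁ c₂ T n w) ≤
        ENNReal.ofReal (cylWeight c₁ c₂ T a b n w ^ q * Dw c₁ c₂ T n ^ s) := fun n w s hs => by
    have hP := one_le_prod_pow hc₁ hc₂ (Ncount T n) (n - Ncount T n)
    rw [hcyl]
    refine ENNReal.ofReal_le_ofReal (mul_le_mul_of_nonneg_left
      (Real.rpow_le_rpow_of_exponent_ge (inv_pos.2 (by linarith)) (inv_le_one_of_one_le₀ hP) hs) ?_)
    rw [cylWeight_rpow q ha' hb']
    exact Finset.prod_nonneg fun i _ => Real.rpow_nonneg (letterWeight_pos ha' hb' i (w i)).le q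
  refine ⟨Measure.infinitePi (letterMeasure c₁ c₂ T a b q), inferInstance, hcyl, fun n w => ?_,
    nk, hnk, fun ε hε => (hsup ε hε).mono fun k hk w => hle _ w _ hk⟩
  rcases eq_or_ne n 0 with rfl | hn
  · rw [hcyl]
    simp [Dw, Ncount_zero]
  · exact hle n w _ (hlim n hn)

end MF
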